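/- Gaps between consecutive lucky numbers, second form: there exist a constant C > 0 and an integer N₀ such that for all n ≥ N₀, l_{n+1} − l_n ≤ C·√n·log n. -/

import Mathlib

open scoped BigOperators

namespace LuckyPaper

/-- Rank of `k` in `A`: the number of elements of `A` that are `≤ k`
(the 1-indexed position of `k` in `A` when `k ∈ A`). -/
noncomputable def rank (A : Set ℕ) (k : ℕ) : ℕ := Set.ncard {m | m ∈ A ∧ m ≤ k}

/-- One sieve step: delete every `d`-th element of `A` (listed in increasing order). -/
noncomputable def step (A : Set ℕ) (d : ℕ) : Set ℕ := {k | k ∈ A ∧ ¬ d ∣ rank A k}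

/-- The lucky sieve: `sieve i = (A_i, l_i)`, where `A_0 = {1,2,3,…}`, `l_0 = 1` (dummy),
`l_{i+1}` is the smallest element of `A_i` larger than `l_i`, and `A_{i+1}` is obtained
from `A_i` by deleting every `l_{i+1}`-th element.  In particular `l_1 = 2`. -/
noncomputable def sieve : ℕ → Set ℕ × ℕ
  | 0 => ({n | 1 ≤ n}, 1)
  | i + 1 =>
      let p := sieve i
      let d := sInf {m | m ∈ p.1 ∧ p.2 < m}
      (step p.1 d, d)

/-- `A i` : the set of survivors after `i` steps of the lucky sieve. -/
noncomputable def A (i : ℕ) : Set ℕ := (sieve i).1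

/-- `l i` : the `i`-th sieve parameter (`l 1 = 2`, `l 2 = 3`, `l 3 = 7`, `l 4 = 9`, …);
with this convention `l n` is the `n`-th lucky number for `n ≥ 2`. -/
noncomputable def l (i : ℕ) : ℕ := (sieve i).2

/-- The set of lucky numbers `A_∞ = ⋂ i, A i = {1, 3, 7, 9, 13, 15, 21, 25, …}`. -/
noncomputable def LuckySet : Set ℕ := ⋂ i, A i

/-- `L x` : the number of lucky numbers that are `≤ x`. -/
noncomputable def L (x : ℝ) : ℕ := Set.ncard {m | m ∈ LuckySet ∧ (m : ℝ) ≤ x}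

/-- `R i x = #{k ∈ A_{i-1} : k ≤ x}`. -/
noncomputable def R (i : ℕ) (x : ℝ) : ℕ := Set.ncard {m | m ∈ A (i - 1) ∧ (m : ℝ) ≤ x}

/-- `𝕃 = {l 1, l 2, l 3, …} = {2, 3, 7, 9, 13, …}`. -/
noncomputable def Ell : Set ℕ := {a | ∃ i, 1 ≤ i ∧ l i = a}

/-- `starIdx i m` : the `m`-th number deleted at step `i` of the sieve, i.e. the
`(l i * m)`-th smallest element of `A (i-1)` (`Nat.nth` is 0-indexed). -/
noncomputable def starIdx (i m : ℕ) : ℕ := Nat.nth (· ∈ A (i - 1)) (l i * m - 1)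

/-- The binary operation `*` : for `a ∈ 𝕃`, `star a m = a * m` is the `m`-th number
deleted at the (unique) step `i ≥ 1` with `l i = a`. -/
noncomputable def star (a m : ℕ) : ℕ := starIdx (sInf {i | 1 ≤ i ∧ l i = a}) m

/-- `evalStar [a₁, …, a_k] = a₁ * (a₂ * (⋯ * a_k)⋯)`. -/
noncomputable def evalStar : List ℕ → ℕ
  | [] => 1
  | [a] => a
  | a :: b :: rest => star a (evalStar (b :: rest))

/-- `t = (a₁, …, a_k)` is a lucky factorization of `n` : `k ≥ 1`, `a_j ∈ 𝕃` for `j < k`,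
`a_k` is a lucky number (possibly 1), and `n = a₁*(a₂*(⋯*a_k)⋯)`. -/
def IsLuckyFactorization (n : ℕ) (t : List ℕ) : Prop :=
  t ≠ [] ∧ (∀ a ∈ t.dropLast, a ∈ Ell) ∧ t.getLast! ∈ LuckySet ∧ evalStar t = n

/-- The canonical tuple of `n` given by the fundamental theorem of arithmetic
for lucky numbers. -/
noncomputable def canonicalTuple (n : ℕ) : List ℕ :=
  haveI := Classical.propDecidable (∃ t, IsLuckyFactorization n t)
  if h : ∃ t, IsLuckyFactorization n t then h.choose else []

/-- `Ω°(n)` : the length of the canonical tuple of `n`. -/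
noncomputable def bigOmega (n : ℕ) : ℕ := (canonicalTuple n).length

/-- `ω°(n)` : the number of distinct entries of the canonical tuple of `n`. -/
noncomputable def smallOmega (n : ℕ) : ℕ := (canonicalTuple n).dedup.length

/-- `d°(n)` : the number of distinct nonempty contiguous subtuples (infixes) of the
canonical tuple of `n`. -/
noncomputable def dCirc (n : ℕ) : ℕ :=
  Set.ncard {s : List ℕ | s ≠ [] ∧ s <:+: canonicalTuple n}

/-- `B` : positive integers whose canonical tuple has last entry `≠ 1`. -/
noncomputable def Bset : Set ℕ := {n | 1 ≤ n ∧ (canonicalTuple n).getLast! ≠ 1}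

/-- `C` : positive integers whose canonical tuple ends with the pair `(2, 1)`. -/
noncomputable def Cset : Set ℕ := {n | 1 ≤ n ∧ ∃ t, canonicalTuple n = t ++ [2, 1]}

/-- `S = B ∪ C`. -/
noncomputable def Sset : Set ℕ := Bset ∪ Cset

/-- The `𝕃`-tuple of `a ∈ S` : the canonical tuple of `a` if it does not end in `1`,
else the canonical tuple with the final `1` removed (so it ends in `2`). -/
noncomputable def ellTuple (a : ℕ) : List ℕ :=
  if (canonicalTuple a).getLast! = 1 then (canonicalTuple a).dropLast else canonicalTuple a

/-- The extended operation `∘` : if the `𝕃`-tuple of `a` is `(t₁, …, t_k)`, then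
`a ∘ b = t₁*(t₂*(⋯*(t_k*b)⋯))`. -/
noncomputable def circ (a b : ℕ) : ℕ := (ellTuple a).foldr star b


theorem rank_succ (S : Set ℕ) (k : ℕ) [Decidable (k + 1 ∈ S)] :
    rank S (k + 1) = rank S k + if k + 1 ∈ S then 1 else 0 := by
  have hfin : {m | m ∈ S ∧ m ≤ k}.Finite := (Set.finite_Iic k).subset fun m hm => hm.2
  unfold rank
  split_ifs with h
  · have : {m | m ∈ S ∧ m ≤ k + 1} = insert (k + 1) {m | m ∈ S ∧ m ≤ k} := by
      ext m
      simp only [Set.mem_ofPred_eq, Set.mem_insert_iff]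
      constructor
      · rintro ⟨h1, h2⟩
        rcases Nat.le_succ_iff.mp h2 with h3 | h3
        · exact Or.inr ⟨h1, h3⟩
        · exact Or.inl h3
      · rintro (rfl | ⟨h1, h2⟩)
        · exact ⟨h, le_rfl⟩
        · exact ⟨h1, by omega⟩
    rw [this, Set.ncard_insert_of_notMem (by simp) hfin]
  · have : {m | m ∈ S ∧ m ≤ k + 1} = {m | m ∈ S ∧ m ≤ k} := by
      ext m
      simp only [Set.mem_ofPred_eq]
      constructor
      · rintro ⟨h1, h2⟩
        rcases Nat.le_succ_iff.mp h2 with h3 | h3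
        · exact ⟨h1, h3⟩
        · exact absurd (by rwa [h3] at h1) h
      · rintro ⟨h1, h2⟩
        exact ⟨h1, by omega⟩
    rw [this, add_zero]

theorem rank_zero {S : Set ℕ} (h : 0 ∉ S) : rank S 0 = 0 := by
  have : {m | m ∈ S ∧ m ≤ 0} = ∅ := by
    ext m
    simp only [Set.mem_ofPred_eq, Set.mem_empty_iff_false, iff_false, not_and]
    rintro h1 h2
    exact h (Nat.le_zero.mp h2 ▸ h1)
  rw [rank, this, Set.ncard_empty]

theorem rank_mono (S : Set ℕ) {a b : ℕ} (h : a ≤ b) : rank S a ≤ rank S b :=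
  Set.ncard_le_ncard (fun _ hm => ⟨hm.1, hm.2.trans h⟩)
    ((Set.finite_Iic b).subset fun _ hm => hm.2)

theorem rank_step {S : Set ℕ} (h : 0 ∉ S) (d k : ℕ) :
    rank (step S d) k = rank S k - rank S k / d := by
  classical
  induction k with
  | zero => rw [rank_zero h, rank_zero fun h0 => h h0.1]; simp
  | succ k ih =>
    rw [rank_succ, ih]
    have hle := Nat.div_le_self (rank S k) d
    by_cases hk : k + 1 ∈ S
    · have hr : rank S (k + 1) = rank S k + 1 := by rw [rank_succ, if_pos hk]
      have hmem : k + 1 ∈ step S d ↔ ¬ d ∣ rank S k + 1 := by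
        rw [← hr]; exact ⟨fun h => h.2, fun h => ⟨hk, h⟩⟩
      rw [hr, Nat.succ_div]
      by_cases hd : d ∣ rank S k + 1
      · rw [if_neg (by simpa [hmem] using hd), if_pos hd]; omega
      · rw [if_pos (hmem.2 hd), if_neg hd]; omega
    · have hr : rank S (k + 1) = rank S k := by rw [rank_succ, if_neg hk, add_zero]
      rw [hr, if_neg fun h => hk h.1, add_zero]

/-- Shifted ranks before and after a sieve step, for a surviving element. -/
theorem rank_sub_one_of_mem_step {S : Set ℕ} (h : 0 ∉ S) {d k : ℕ} (hd : 2 ≤ d)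
    (hk : k ∈ step S d) :
    rank S k - 1 = (rank (step S d) k - 1) + (rank (step S d) k - 1) / (d - 1) := by
  have hdvd : ¬ d ∣ rank S k := hk.2
  rw [rank_step h]
  generalize rank S k = r at *
  obtain ⟨e, rfl⟩ : ∃ e, d = e + 1 := ⟨d - 1, by omega⟩
  have hmod : 0 < r % (e + 1) := Nat.pos_of_ne_zero fun h0 => hdvd (Nat.dvd_of_mod_eq_zero h0)
  have hlt : r % (e + 1) < e + 1 := Nat.mod_lt _ (by omega)
  have hdm := Nat.div_add_mod r (e + 1)
  set q := r / (e + 1)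
  set t := r % (e + 1)
  have h1 : r - q - 1 = (t - 1) + e * q := by
    have : (e + 1) * q = e * q + q := by ring
    omega
  rw [h1, Nat.add_sub_cancel, Nat.add_mul_div_left _ _ (by omega),
    Nat.div_eq_of_lt (by omega : t - 1 < e)]
  have : (e + 1) * q = e * q + q := by ring
  omega

theorem A_zero : A 0 = {n | 1 ≤ n} := rfl

theorem l_succ (i : ℕ) : l (i + 1) = sInf {m | m ∈ A i ∧ l i < m} := rfl

theorem A_succ (i : ℕ) : A (i + 1) = step (A i) (l (i + 1)) := rfl

theorem A_antitone : Antitone A :=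
  antitone_nat_of_succ_le fun i => by rw [A_succ]; exact fun _ hk => hk.1

theorem zero_notMem_A (i : ℕ) : 0 ∉ A i := fun h => by
  have := A_antitone (Nat.zero_le i) h
  simp [A_zero] at this

theorem rank_A_zero (k : ℕ) : rank (A 0) k = k := by
  classical
  induction k with
  | zero => exact rank_zero (zero_notMem_A 0)
  | succ k ih => rw [rank_succ, ih, if_pos (by simp [A_zero])]

theorem exists_mem_of_rank_lt {S : Set ℕ} {a b : ℕ} (h : rank S a < rank S b) :
    ∃ m ∈ S, a < m := by
  by_contra! hc
  have : rank S b ≤ rank S a :=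
    Set.ncard_le_ncard (fun m hm => ⟨hm.1, hc m hm.1⟩)
      ((Set.finite_Iic a).subset fun m hm => hm.2)
  omega

theorem l_succ_mem_of_unbounded {i : ℕ} (h : ∀ N, ∃ k, N ≤ rank (A i) k) :
    l (i + 1) ∈ A i ∧ l i < l (i + 1) := by
  obtain ⟨k, hk⟩ := h (rank (A i) (l i) + 1)
  obtain ⟨m, hm, hlt⟩ := exists_mem_of_rank_lt (S := A i) (a := l i) (b := k) (by omega)
  exact Nat.sInf_mem (s := {m | m ∈ A i ∧ l i < m}) ⟨m, hm, hlt⟩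

theorem unbounded_and_lt (i : ℕ) : (∀ N, ∃ k, N ≤ rank (A i) k) ∧ i < l i := by
  induction i with
  | zero => exact ⟨fun N => ⟨N, (rank_A_zero N).ge⟩, Nat.one_pos⟩
  | succ i ih =>
    have hl := l_succ_mem_of_unbounded ih.1
    refine ⟨fun N => ?_, by omega⟩
    obtain ⟨k, hk⟩ := ih.1 (2 * N)
    refine ⟨k, ?_⟩
    rw [A_succ, rank_step (zero_notMem_A i)]
    have : rank (A i) k / l (i + 1) ≤ rank (A i) k / 2 :=
      Nat.div_le_div_left (by omega) (by omega)
    omega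

theorem lt_l (i : ℕ) : i < l i := (unbounded_and_lt i).2

theorem l_succ_mem (i : ℕ) : l (i + 1) ∈ A i := (l_succ_mem_of_unbounded (unbounded_and_lt i).1).1

theorem l_lt_succ (i : ℕ) : l i < l (i + 1) := (l_succ_mem_of_unbounded (unbounded_and_lt i).1).2

theorem rank_l_succ (i : ℕ) : rank (A i) (l (i + 1)) = rank (A i) (l i) + 1 := by
  have hset : {m | m ∈ A i ∧ m ≤ l (i + 1)} = insert (l (i + 1)) {m | m ∈ A i ∧ m ≤ l i} := by
    ext m
    simp only [Set.mem_ofPred_eq, Set.mem_insert_iff]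
    constructor
    · rintro ⟨h1, h2⟩
      by_cases h3 : m ≤ l i
      · exact Or.inr ⟨h1, h3⟩
      · left
        refine le_antisymm h2 ?_
        rw [l_succ]
        exact Nat.sInf_le ⟨h1, not_le.mp h3⟩
    · rintro (rfl | ⟨h1, h2⟩)
      · exact ⟨l_succ_mem i, le_rfl⟩
      · exact ⟨h1, h2.trans (l_lt_succ i).le⟩
  rw [rank, hset, Set.ncard_insert_of_notMem (by simp [l_lt_succ i])
    ((Set.finite_Iic (l i)).subset fun m hm => hm.2), rank]

theorem l_one : l 1 = 2 := by
  have := rank_l_succ 0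
  rw [rank_A_zero, rank_A_zero] at this
  exact this

theorem rank_l {i : ℕ} (hi : 1 ≤ i) : rank (A i) (l i) = i := by
  induction i, hi using Nat.le_induction with
  | base => rw [A_succ, rank_step (zero_notMem_A 0), rank_A_zero, l_one]
  | succ i _ ih =>
    rw [A_succ, rank_step (zero_notMem_A i), rank_l_succ, ih,
      Nat.div_eq_of_lt (lt_l (i + 1)), Nat.sub_zero]

theorem rank_A_l_succ {i : ℕ} (hi : 1 ≤ i) : rank (A i) (l (i + 1)) = i + 1 := by
  rw [rank_l_succ, rank_l hi]

theorem l_mem {i : ℕ} (hi : 2 ≤ i) : l i ∈ A i := by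
  obtain ⟨i, rfl⟩ : ∃ j, i = j + 1 := ⟨i - 1, by omega⟩
  rw [A_succ]
  refine ⟨l_succ_mem i, ?_⟩
  rw [rank_A_l_succ (by omega)]
  exact Nat.not_dvd_of_pos_of_lt (by omega) (lt_l _)

theorem odd_l {i : ℕ} (hi : 2 ≤ i) : Odd (l i) := by
  obtain ⟨i, rfl⟩ : ∃ j, i = j + 1 := ⟨i - 1, by omega⟩
  have h := A_antitone (by omega : 1 ≤ i) (l_succ_mem i)
  rw [A_succ, l_one] at h
  have := h.2
  rw [rank_A_zero] at this
  exact Nat.not_even_iff_odd.mp fun he => this he.two_dvd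

theorem l_add_two_le {i : ℕ} (hi : 2 ≤ i) : l i + 2 ≤ l (i + 1) := by
  have h1 := l_lt_succ i
  obtain ⟨a, ha⟩ := odd_l hi
  obtain ⟨b, hb⟩ := odd_l (by omega : 2 ≤ i + 1)
  omega

/-- The shifted sieve parameter `l i - 1`. -/
noncomputable def gapMod (i : ℕ) : ℕ := l i - 1

theorem le_gapMod (i : ℕ) : i ≤ gapMod i := by
  have := lt_l i
  unfold gapMod
  omega

theorem gapMod_one : gapMod 1 = 1 := by rw [gapMod, l_one]

theorem gapMod_add_two_le {i : ℕ} (hi : 2 ≤ i) : gapMod i + 2 ≤ gapMod (i + 1) := by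
  have := l_add_two_le hi
  have := lt_l i
  unfold gapMod
  omega

/-- The 0-indexed position of `x` in `A i`. -/
noncomputable def pos (x i : ℕ) : ℕ := rank (A i) x - 1

theorem pos_zero (x : ℕ) : pos x 0 = x - 1 := by rw [pos, rank_A_zero]

theorem pos_rec {x n : ℕ} (hx : x ∈ A n) {i : ℕ} (hi : i < n) :
    pos x i = pos x (i + 1) + pos x (i + 1) / gapMod (i + 1) := by
  have h := A_antitone (by omega : i + 1 ≤ n) hx
  rw [A_succ] at h
  have := lt_l (i + 1)
  exact rank_sub_one_of_mem_step (d := l (i + 1)) (zero_notMem_A i) (by omega) h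

theorem pos_mono {x y : ℕ} (h : x ≤ y) (i : ℕ) : pos x i ≤ pos y i :=
  Nat.sub_le_sub_right (rank_mono _ h) 1

/-- The reciprocal density of `A i`. -/
noncomputable def invDensity (i : ℕ) : ℝ := ∏ k ∈ Finset.range i, (1 + 1 / (gapMod (k + 1) : ℝ))

theorem invDensity_zero : invDensity 0 = 1 := Finset.prod_range_zero _

theorem invDensity_succ (i : ℕ) :
    invDensity (i + 1) = invDensity i * (1 + 1 / (gapMod (i + 1) : ℝ)) :=
  Finset.prod_range_succ _ _

theorem gapMod_pos (i : ℕ) : (0 : ℝ) < gapMod (i + 1) := by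
  have := le_gapMod (i + 1)
  exact_mod_cast (by omega : 0 < gapMod (i + 1))

theorem invDensity_pos (i : ℕ) : 0 < invDensity i :=
  Finset.prod_pos fun k _ => by have := gapMod_pos k; positivity

theorem invDensity_mono : Monotone invDensity := monotone_nat_of_le_succ fun i => by
  rw [invDensity_succ]
  have := gapMod_pos i
  exact le_mul_of_one_le_right (invDensity_pos i).le (by simp)

theorem invDensity_div_antitone : Antitone fun i : ℕ => invDensity i / (i + 1) :=
  antitone_nat_of_succ_le fun i => by
    rw [invDensity_succ]
    have h0 := invDensity_pos i
    have h1 : ((i : ℝ) + 1) ≤ gapMod (i + 1) := by exact_mod_cast le_gapMod (i + 1)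
    have h2 : 1 / (gapMod (i + 1) : ℝ) ≤ 1 / ((i : ℝ) + 1) :=
      one_div_le_one_div_of_le (by positivity) h1
    calc invDensity i * (1 + 1 / (gapMod (i + 1) : ℝ)) / (((i + 1 : ℕ) : ℝ) + 1)
        ≤ invDensity i * (1 + 1 / ((i : ℝ) + 1)) / (((i + 1 : ℕ) : ℝ) + 1) := by gcongr
      _ = invDensity i / (i + 1) := by push_cast; field_simp

theorem pos_le {x n : ℕ} (hx : x ∈ A n) {i j : ℕ} (hij : i ≤ j) (hj : j ≤ n) :
    invDensity i * pos x i ≤ invDensity j * pos x j := by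
  induction j, hij using Nat.le_induction with
  | base => exact le_rfl
  | succ j _ ih =>
    refine (ih (by omega)).trans ?_
    rw [invDensity_succ, pos_rec hx (by omega : j < n), mul_assoc]
    refine mul_le_mul_of_nonneg_left ?_ (invDensity_pos j).le
    have := @Nat.cast_div_le ℝ _ _ _ (pos x (j + 1)) (gapMod (j + 1))
    push_cast
    calc _ ≤ (pos x (j + 1) : ℝ) + pos x (j + 1) / gapMod (j + 1) := by gcongr
      _ = _ := by ring

theorem le_pos_zero {x n : ℕ} (hx : x ∈ A n) {i : ℕ} (hi : i ≤ n) :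
    invDensity i * ((pos x i : ℝ) - i) ≤ pos x 0 := by
  induction i with
  | zero => simp [invDensity_zero]
  | succ i ih =>
    refine le_trans ?_ (ih (by omega))
    rw [invDensity_succ, pos_rec hx (by omega : i < n), mul_assoc]
    refine mul_le_mul_of_nonneg_left ?_ (invDensity_pos i).le
    have h := Nat.lt_floor_add_one ((pos x (i + 1) : ℝ) / gapMod (i + 1))
    rw [Nat.floor_div_natCast, Nat.floor_natCast] at h
    have h2 : (0 : ℝ) ≤ ((i : ℝ) + 1) / gapMod (i + 1) := by positivity
    push_cast
    have : (1 + 1 / (gapMod (i + 1) : ℝ)) * ((pos x (i + 1) : ℝ) - (i + 1)) =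
      pos x (i + 1) + (pos x (i + 1) : ℝ) / gapMod (i + 1) - (i + 1)
        - ((i : ℝ) + 1) / gapMod (i + 1) := by ring
    linarith

theorem pos_l_succ {i : ℕ} (hi : 1 ≤ i) : pos (l (i + 1)) i = i := by
  rw [pos, rank_A_l_succ hi, Nat.add_sub_cancel]

theorem gapMod_succ_le (i : ℕ) : (gapMod (i + 1) : ℝ) ≤ invDensity i * (i + 1) := by
  rcases Nat.eq_zero_or_pos i with rfl | hi
  · simp [gapMod_one, invDensity_zero]
  · have h := pos_le (l_succ_mem i) (Nat.zero_le i) le_rfl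
    rw [pos_l_succ hi, invDensity_zero, pos_zero, one_mul] at h
    exact h.trans (by have := invDensity_pos i; gcongr; linarith)

theorem invDensity_le_eight_mul (i : ℕ) : invDensity i * (i + 1) ≤ 8 * gapMod (i + 1) := by
  have hd : ((i : ℝ) + 1) ≤ gapMod (i + 1) := by exact_mod_cast le_gapMod (i + 1)
  rcases Nat.lt_or_ge i 8 with h8 | h8
  · have h := invDensity_div_antitone (Nat.zero_le i)
    simp only [invDensity_zero, Nat.cast_zero, zero_add, div_one] at h
    rw [div_le_one (by positivity)] at h
    have : (i : ℝ) + 1 ≤ 8 := by exact_mod_cast (by omega : i + 1 ≤ 8)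
    nlinarith
  · have hs : 2 * (i / 2) ≤ i := Nat.mul_div_le i 2
    have hs' : i ≤ 2 * (i / 2) + 1 := by omega
    generalize i / 2 = s at hs hs'
    have hsi : s ≤ i := by omega
    have h := invDensity_div_antitone hsi
    simp only at h
    rw [div_le_div_iff₀ (by positivity) (by positivity)] at h
    have h1 := le_pos_zero (l_succ_mem i) hsi
    have h2 : (i : ℝ) ≤ pos (l (i + 1)) s := by
      have : pos (l (i + 1)) i ≤ pos (l (i + 1)) s := by
        have key : ∀ j, s ≤ j → j ≤ i → pos (l (i + 1)) j ≤ pos (l (i + 1)) s := by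
          intro j hj
          induction j, hj using Nat.le_induction with
          | base => exact fun _ => le_rfl
          | succ j _ ih =>
            intro hji
            refine le_trans ?_ (ih (by omega))
            rw [pos_rec (l_succ_mem i) (by omega : j < i)]
            exact Nat.le_add_right _ _
        exact key i hsi le_rfl
      rw [pos_l_succ (by omega)] at this
      exact_mod_cast this
    rw [pos_zero] at h1
    change _ ≤ ((gapMod (i + 1) : ℕ) : ℝ) at h1
    have hp := invDensity_pos s
    have hp' := invDensity_pos i
    have e1 : 2 * (s : ℝ) ≤ i := by exact_mod_cast hs
    have e2 : (i : ℝ) ≤ 2 * s + 1 := by exact_mod_cast hs'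
    have e3 : (8 : ℝ) ≤ i := by exact_mod_cast h8
    have h3 : invDensity s * ((i : ℝ) - s) ≤ gapMod (i + 1) :=
      le_trans (mul_le_mul_of_nonneg_left (by linarith) hp.le) h1
    have h4 : invDensity i ≤ 2 * invDensity s := by
      have : invDensity i * (s + 1) ≤ (2 * invDensity s) * (s + 1) :=
        h.trans (by nlinarith)
      exact le_of_mul_le_mul_right this (by positivity)
    nlinarith

theorem harmonic_le_invDensity (i : ℕ) : (harmonic i : ℝ) ≤ invDensity i := by
  induction i with
  | zero => simp [invDensity_zero]
  | succ i ih =>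
    rw [harmonic_succ, invDensity_succ, mul_add, mul_one]
    push_cast
    refine add_le_add ih ?_
    rw [mul_one_div, inv_eq_one_div, div_le_div_iff₀ (by positivity) (gapMod_pos i), one_mul]
    exact gapMod_succ_le i

theorem invDensity_le_harmonic (i : ℕ) : invDensity i ≤ 1 + 8 * (harmonic i : ℝ) := by
  induction i with
  | zero => simp [invDensity_zero]
  | succ i ih =>
    rw [harmonic_succ, invDensity_succ, mul_add, mul_one]
    push_cast
    have : invDensity i * (1 / (gapMod (i + 1) : ℝ)) ≤ 8 * ((i : ℝ) + 1)⁻¹ := by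
      rw [mul_one_div, ← div_eq_mul_inv, div_le_div_iff₀ (gapMod_pos i) (by positivity)]
      exact invDensity_le_eight_mul i
    linarith

theorem log_le_invDensity (i : ℕ) : Real.log (i + 1) ≤ invDensity i := by
  have := log_add_one_le_harmonic i
  push_cast at this
  exact this.trans (harmonic_le_invDensity i)

theorem invDensity_le_log (i : ℕ) : invDensity i ≤ 9 + 8 * Real.log i := by
  have := harmonic_le_one_add_log i
  linarith [invDensity_le_harmonic i]

/-- One sieve step increases the gap by at most one, as long as the gap is small compared
with the sieve parameter; the bound by the quotient is preserved. -/
theorem gap_step {a b d d' : ℕ} (hd : 0 < d) (hdd : d + 2 ≤ d') (hab : a ≤ b)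
    (hgap : b - a ≤ b / d' + 1) (hsmall : b / d' + 1 ≤ d) :
    (b + b / d) - (a + a / d) ≤ (b + b / d) / d + 1 := by
  have hmono : b / d ≤ (b + b / d) / d := Nat.div_le_div_right (Nat.le_add_right _ _)
  have hq : b / d' ≤ b / d := Nat.div_le_div_left (by omega) hd
  have hle : b / d ≤ a / d + 1 := by
    rw [← Nat.add_div_right a hd]
    exact Nat.div_le_div_right (by omega)
  have hab' : a / d ≤ b / d := Nat.div_le_div_right hab
  rcases Nat.lt_or_ge (a / d) (b / d) with h | h
  · rcases Nat.lt_or_ge (b / d') (b / d) with h' | h'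
    · omega
    · exfalso
      have hqe : b / d' = b / d := le_antisymm hq h'
      have h1 : d' * (b / d') ≤ b := Nat.mul_div_le b d'
      have h2 : a < (b / d) * d := (Nat.div_lt_iff_lt_mul hd).mp h
      rw [hqe] at h1 hgap
      have h3 : (d + 2) * (b / d) ≤ d' * (b / d) := Nat.mul_le_mul_right _ hdd
      have h4 : (d + 2) * (b / d) = b / d * d + 2 * (b / d) := by ring
      have h5 : 0 ≤ a / d := Nat.zero_le _
      omega
  · omega

/-- The gap bound along the sieve: at stages where the sieve parameter is large,
the gap is at most the quotient plus one. -/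
theorem gap_le_quotient {x y n m : ℕ} (hx : x ∈ A n) (hy : y ∈ A n) (hxy : x ≤ y)
    (hbase : pos y n - pos x n ≤ 1) (hm : 1 ≤ m)
    (hsmall : ∀ i, m ≤ i → i < n → pos y (i + 1) / gapMod (i + 2) + 1 ≤ gapMod (i + 1))
    {i : ℕ} (hmi : m ≤ i) (hin : i ≤ n) :
    pos y i - pos x i ≤ pos y i / gapMod (i + 1) + 1 := by
  induction hin using Nat.decreasingInduction with
  | self => exact hbase.trans (Nat.le_add_left _ _)
  | of_succ k hk ih =>
    have h := le_gapMod (k + 1)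
    rw [pos_rec hx hk, pos_rec hy hk]
    exact gap_step (by omega) (gapMod_add_two_le (by omega)) (pos_mono hxy _)
      (ih (by omega)) (hsmall k hmi hk)

/-- The gap at the initial stage is controlled by the gap at stage `i`. -/
theorem gap_zero_le {x y n : ℕ} (hx : x ∈ A n) (hy : y ∈ A n) {i : ℕ} (hi : i ≤ n) :
    (pos y 0 : ℝ) - pos x 0 ≤ invDensity i * ((pos y i : ℝ) - pos x i + i) := by
  induction i with
  | zero => simp [invDensity_zero]
  | succ i ih =>
    refine (ih (by omega)).trans ?_
    rw [invDensity_succ, pos_rec hx (by omega : i < n), pos_rec hy (by omega : i < n), mul_assoc]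
    refine mul_le_mul_of_nonneg_left ?_ (invDensity_pos i).le
    have h := Nat.lt_floor_add_one ((pos x (i + 1) : ℝ) / gapMod (i + 1))
    rw [Nat.floor_div_natCast, Nat.floor_natCast] at h
    have h1 := @Nat.cast_div_le ℝ _ _ _ (pos y (i + 1)) (gapMod (i + 1))
    have h2 : (0 : ℝ) ≤ ((i : ℝ) + 1) / gapMod (i + 1) := by positivity
    push_cast
    have : (1 + 1 / (gapMod (i + 1) : ℝ)) * ((pos y (i + 1) : ℝ) - pos x (i + 1) + (i + 1)) =
      (pos y (i + 1) : ℝ) - pos x (i + 1) + (i + 1) + (pos y (i + 1) : ℝ) / gapMod (i + 1)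
        - (pos x (i + 1) : ℝ) / gapMod (i + 1) + ((i : ℝ) + 1) / gapMod (i + 1) := by ring
    linarith

/-- gaps between consecutive lucky numbers, second form: there exist
`C > 0` and `N₀` such that for all `n ≥ N₀`, `l_{n+1} − l_n ≤ C·√n·log n`. -/
theorem lucky_gap_bound' :
    ∃ C : ℝ, 0 < C ∧ ∃ N₀ : ℕ, ∀ n : ℕ, N₀ ≤ n →
      (l (n + 1) : ℝ) - (l n : ℝ) ≤ C * Real.sqrt (n : ℝ) * Real.log (n : ℝ) := by
  refine ⟨400, by norm_num, 100, fun n hn => ?_⟩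
  have hx : l n ∈ A n := l_mem (by omega)
  have hy : l (n + 1) ∈ A n := l_succ_mem n
  have hpx : pos (l n) n = n - 1 := by rw [pos, rank_l (by omega)]
  have hpy : pos (l (n + 1)) n = n := pos_l_succ (by omega)
  have hn' : (100 : ℝ) ≤ n := by exact_mod_cast hn
  have hlog : 1 ≤ Real.log n := by
    rw [Real.le_log_iff_exp_le (by linarith)]
    linarith [Real.exp_one_lt_d9]
  obtain ⟨s, hs⟩ : ∃ s, s = Nat.sqrt n := ⟨_, rfl⟩
  have hs1 : s * s ≤ n := hs ▸ Nat.sqrt_le n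
  have hs2 : n < (s + 1) * (s + 1) := hs ▸ Nat.lt_succ_sqrt n
  have hs10 : 10 ≤ s := by rw [hs, Nat.le_sqrt]; omega
  set m := 7 * (s + 1) with hm
  have hmn : m ≤ n := by nlinarith
  have hpos : ∀ i, m ≤ i → i ≤ n → pos (l (n + 1)) i ≤ 34 * n := by
    intro i hmi hin
    have h1 := pos_le hy hin le_rfl
    rw [hpy] at h1
    have h2 : Real.log n ≤ 2 * invDensity i := by
      have h3 : (n : ℝ) ≤ ((i : ℝ) + 1) ^ 2 := by
        exact_mod_cast (by nlinarith : n ≤ (i + 1) ^ 2)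
      have := Real.log_le_log (by linarith) h3
      rw [Real.log_pow] at this
      push_cast at this
      linarith [log_le_invDensity i]
    have h4 := invDensity_le_log n
    have h5 : invDensity n ≤ 34 * invDensity i := by linarith
    have h6 : invDensity i * pos (l (n + 1)) i ≤ invDensity i * (34 * n) := by nlinarith
    exact_mod_cast le_of_mul_le_mul_left h6 (invDensity_pos i)
  have hgap := gap_le_quotient hx hy (l_lt_succ n).le (by omega) (by omega : 1 ≤ m)
    (fun i hmi hin => by
      have h1 := hpos (i + 1) (by omega) hin
      have h2 := le_gapMod (i + 2)
      have h3 := le_gapMod (i + 1)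
      have : pos (l (n + 1)) (i + 1) / gapMod (i + 2) < i + 1 := by
        rw [Nat.div_lt_iff_lt_mul (by omega)]
        nlinarith
      omega) le_rfl hmn
  have hgap' : pos (l (n + 1)) m - pos (l n) m ≤ 5 * (s + 1) := by
    have h1 := hpos m le_rfl hmn
    have h2 := le_gapMod (m + 1)
    have : pos (l (n + 1)) m / gapMod (m + 1) < 5 * (s + 1) := by
      rw [Nat.div_lt_iff_lt_mul (by omega)]
      nlinarith
    omega
  have hfin := gap_zero_le hx hy hmn
  rw [pos_zero, pos_zero, Nat.cast_sub (lt_l n |>.trans' (by omega)),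
    Nat.cast_sub (lt_l (n + 1) |>.trans' (by omega))] at hfin
  have hg : (pos (l (n + 1)) m : ℝ) - pos (l n) m ≤ 5 * (s + 1) := by
    have : pos (l (n + 1)) m ≤ 5 * (s + 1) + pos (l n) m := by omega
    have : (pos (l (n + 1)) m : ℝ) ≤ 5 * (s + 1) + pos (l n) m := by exact_mod_cast this
    linarith
  have hmc : (m : ℝ) = 7 * (s + 1) := by rw [hm]; push_cast; ring
  have hsq : (s : ℝ) + 1 ≤ 1.1 * Real.sqrt n := by
    have h1 : (s : ℝ) ≤ Real.sqrt n := Real.le_sqrt_of_sq_le (by exact_mod_cast (by nlinarith))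
    have h2 : (10 : ℝ) ≤ Real.sqrt n := Real.le_sqrt_of_sq_le (by linarith)
    linarith
  have hQ : invDensity m ≤ 17 * Real.log n := by
    have h1 := invDensity_mono hmn
    have h2 := invDensity_le_log n
    linarith
  calc (l (n + 1) : ℝ) - l n ≤ invDensity m * ((pos (l (n + 1)) m : ℝ) - pos (l n) m + m) := by
        linarith
    _ ≤ (17 * Real.log n) * (12 * (1.1 * Real.sqrt n)) :=
        mul_le_mul hQ (by linarith)
          (by
            have : (pos (l n) m : ℝ) ≤ pos (l (n + 1)) m := by
              exact_mod_cast pos_mono (l_lt_succ n).le m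
            linarith) (by positivity)
    _ ≤ 400 * Real.sqrt n * Real.log n := by
        have : 0 ≤ Real.sqrt n * Real.log n := by positivity
        linarith

end LuckyPaper
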